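/- Let S be the Pfaffian system on ℝ⁹ of the elementary model (3.1.3.3.1.), spanned by the seven 1-forms ω¹ = dx²+x³dx¹, ω² = dx³+x⁴dx¹, ω³ = dx¹+x⁵dx⁴, ω⁴ = dx⁵+x⁶dx⁴, ω⁵ = dx⁴+x⁷dx⁶, ω⁶ = dx⁶+x⁸dx⁷, ω⁷ = dx⁸+x⁹dx⁷. There is no diffeomorphism φ between open neighborhoods of the points p = (0,0,0,0,0,1,0,0,1) and q = (0,0,0,0,0,1,0,0,−1) with φ(p) = q such that, for every x in the source neighborhood, the transpose of dφ_x maps the span of ω¹(φ(x)),…,ω⁷(φ(x)) onto the span of ω¹(x),…,ω⁷(x). Consequently the flag models (3.𝟐.3.3.𝟐.) and (3.𝟐.3.3.𝟐−.) (with constants of opposite signs at the last position) are not locally equivalent. -/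

import Mathlib

open scoped BigOperators

noncomputable section

/-- The coordinate 1-form `dxⁱ` on `ℝⁿ` (as a constant continuous linear functional). -/
def dxi {n : ℕ} (i : Fin n) : (Fin n → ℝ) →L[ℝ] ℝ := ContinuousLinearMap.proj i

/-- The Lie derivative `θ(ξ)ω = d(ι(ξ)ω) + ι(ξ)(dω)` of a 1-form `ω` along a vector
field `ξ`, evaluated at the point `x` on the tangent vector `v`.  Here
`ι(ξ)ω : x ↦ ω_x(ξ x)`, `d` of a function is `fderiv`, and
`(dω)_x(u,v) = (D_u ω)(v) − (D_v ω)(u)`. -/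
def lieD {n : ℕ} (ξ : (Fin n → ℝ) → (Fin n → ℝ))
    (ω : (Fin n → ℝ) → (Fin n → ℝ) →L[ℝ] ℝ) (x v : Fin n → ℝ) : ℝ :=
  fderiv ℝ (fun y => ω y (ξ y)) x v
    + ((fderiv ℝ ω x (ξ x)) v - (fderiv ℝ ω x v) (ξ x))

/-- `ξ` is an infinitesimal automorphism of the Pfaffian system spanned by the
1-forms `ω 0, …, ω (r-1)` : each Lie derivative `θ(ξ)(ω i)` lies, at every point,
in the linear span of the `ω j`. -/
def IsIA {n r : ℕ} (ω : Fin r → (Fin n → ℝ) → (Fin n → ℝ) →L[ℝ] ℝ)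
    (ξ : (Fin n → ℝ) → (Fin n → ℝ)) : Prop :=
  ∀ i : Fin r, ∀ x : Fin n → ℝ, ∃ c : Fin r → ℝ,
    ∀ v : Fin n → ℝ, lieD ξ (ω i) x v = ∑ j, c j * ω j x v

/-- The partial derivative `∂f/∂xⁱ`. -/
def pd {n : ℕ} (i : Fin n) (f : (Fin n → ℝ) → ℝ) : (Fin n → ℝ) → ℝ :=
  fun x => fderiv ℝ f x (Pi.single i 1)

/-- The Darboux contact form `ω = dx² + x³dx¹` on `ℝ³`. -/
def darboux (x : Fin 3 → ℝ) : (Fin 3 → ℝ) →L[ℝ] ℝ := dxi 1 + x 2 • dxi 0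


/-- The elementary model (3.1.3.3.1.) on `ℝ⁹`, spanned by `ω¹ = dx²+x³dx¹`,
`ω² = dx³+x⁴dx¹`, `ω³ = dx¹+x⁵dx⁴`, `ω⁴ = dx⁵+x⁶dx⁴`, `ω⁵ = dx⁴+x⁷dx⁶`,
`ω⁶ = dx⁶+x⁸dx⁷`, `ω⁷ = dx⁸+x⁹dx⁷`. -/
def model31331 : Fin 7 → (Fin 9 → ℝ) → (Fin 9 → ℝ) →L[ℝ] ℝ :=
  ![fun x => dxi 1 + x 2 • dxi 0, fun x => dxi 2 + x 3 • dxi 0,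
    fun x => dxi 0 + x 4 • dxi 3, fun x => dxi 4 + x 5 • dxi 3,
    fun x => dxi 3 + x 6 • dxi 5, fun x => dxi 5 + x 7 • dxi 6,
    fun x => dxi 7 + x 8 • dxi 6]

/-- The model (3.𝟐.3.3.𝟐.) on `ℝ⁹` (constants `+1` at both 𝟐-positions). -/
def model32332p : Fin 7 → (Fin 9 → ℝ) → (Fin 9 → ℝ) →L[ℝ] ℝ :=
  ![fun x => dxi 1 + x 2 • dxi 0, fun x => dxi 2 + x 3 • dxi 0,
    fun x => dxi 0 + x 4 • dxi 3, fun x => dxi 4 + (x 5 + 1) • dxi 3,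
    fun x => dxi 3 + x 6 • dxi 5, fun x => dxi 5 + x 7 • dxi 6,
    fun x => dxi 7 + (x 8 + 1) • dxi 6]

/-- The model (3.𝟐.3.3.𝟐−.) on `ℝ⁹` (constant `−1` at the last 𝟐-position). -/
def model32332m : Fin 7 → (Fin 9 → ℝ) → (Fin 9 → ℝ) →L[ℝ] ℝ :=
  ![fun x => dxi 1 + x 2 • dxi 0, fun x => dxi 2 + x 3 • dxi 0,
    fun x => dxi 0 + x 4 • dxi 3, fun x => dxi 4 + (x 5 + 1) • dxi 3,
    fun x => dxi 3 + x 6 • dxi 5, fun x => dxi 5 + x 7 • dxi 6,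
    fun x => dxi 7 + (x 8 - 1) • dxi 6]

/-- The span at `x` of a finite family of 1-forms. -/
def spanAt {n r : ℕ} (ω : Fin r → (Fin n → ℝ) → (Fin n → ℝ) →L[ℝ] ℝ)
    (x : Fin n → ℝ) : Submodule ℝ ((Fin n → ℝ) →L[ℝ] ℝ) :=
  Submodule.span ℝ (Set.range fun i => ω i x)

/-- The pullback, by the transpose of `dφ_x`, of the span at `φ x` of a finite
family of 1-forms. -/
def pullbackSpanAt {n r : ℕ} (ω : Fin r → (Fin n → ℝ) → (Fin n → ℝ) →L[ℝ] ℝ)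
    (φ : (Fin n → ℝ) → (Fin n → ℝ)) (x : Fin n → ℝ) :
    Submodule ℝ ((Fin n → ℝ) →L[ℝ] ℝ) :=
  Submodule.span ℝ (Set.range fun i => (ω i (φ x)).comp (fderiv ℝ φ x))

section FlagGeometry

variable {n : ℕ}

/-- Directional derivative of the vanishing of `φ^*(dx^a + x^c dx^b)` along a vector field. -/
theorem deriv_pullback_eq_zero {U : Set (Fin n → ℝ)} (hU : IsOpen U)
    {φ : (Fin n → ℝ) → (Fin n → ℝ)} (hφ : ContDiffOn ℝ (⊤ : ℕ∞) φ U) {a b c : Fin n}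
    {V : (Fin n → ℝ) → (Fin n → ℝ)} {x : Fin n → ℝ} (hx : x ∈ U)
    (hV : DifferentiableAt ℝ V x)
    (h : ∀ y ∈ U, fderiv ℝ φ y (V y) a + φ y c * fderiv ℝ φ y (V y) b = 0) (u : Fin n → ℝ) :
    fderiv ℝ (fderiv ℝ φ) x u (V x) a + fderiv ℝ φ x (fderiv ℝ V x u) a
      + fderiv ℝ φ x u c * fderiv ℝ φ x (V x) b
      + φ x c * (fderiv ℝ (fderiv ℝ φ) x u (V x) b + fderiv ℝ φ x (fderiv ℝ V x u) b) = 0 := by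
  have hc : ContDiffAt ℝ (⊤ : ℕ∞) φ x := hφ.contDiffAt (hU.mem_nhds hx)
  have h1 : HasFDerivAt φ (fderiv ℝ φ x) x := (hc.differentiableAt (by simp)).hasFDerivAt
  have h2 : HasFDerivAt (fderiv ℝ φ) (fderiv ℝ (fderiv ℝ φ) x) x :=
    ((hc.fderiv_right (m := 1) (by norm_cast)).differentiableAt (by simp)).hasFDerivAt
  have h3 := h2.clm_apply hV.hasFDerivAt
  have h4 := ((hasFDerivAt_pi'.1 h3 a).add
    ((hasFDerivAt_pi'.1 h1 c).mul (hasFDerivAt_pi'.1 h3 b)))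
  have h5 := h4.congr_of_eventuallyEq (f₁ := fun _ => (0 : ℝ)) (by
    filter_upwards [hU.mem_nhds hx] with y hy
    exact (h y hy).symm)
  have h6 := congrArg (fun l => l u) (h5.unique (hasFDerivAt_const (0 : ℝ) x))
  simp at h6
  linarith

/-- Cartan's formula for `φ^*(dx^a + x^c dx^b)` on a constant field `u` and a field `V`
that are both annihilated by it, where `w = [u, V]`. -/
theorem pullback_bracket {U : Set (Fin n → ℝ)} (hU : IsOpen U)
    {φ : (Fin n → ℝ) → (Fin n → ℝ)} (hφ : ContDiffOn ℝ (⊤ : ℕ∞) φ U) {a b c : Fin n}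
    {V : (Fin n → ℝ) → (Fin n → ℝ)} (hV : Differentiable ℝ V) {u : Fin n → ℝ}
    (h : ∀ y ∈ U, fderiv ℝ φ y (V y) a + φ y c * fderiv ℝ φ y (V y) b = 0)
    (hu : ∀ y ∈ U, fderiv ℝ φ y u a + φ y c * fderiv ℝ φ y u b = 0)
    {x w : Fin n → ℝ} (hx : x ∈ U) (hw : ∀ t : ℝ, V (x + t • u) = V x + t • w) :
    fderiv ℝ φ x w a + φ x c * fderiv ℝ φ x w b
      = fderiv ℝ φ x (V x) c * fderiv ℝ φ x u b - fderiv ℝ φ x u c * fderiv ℝ φ x (V x) b := by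
  have hw' : fderiv ℝ V x u = w := by
    rw [← (hV x).lineDeriv_eq_fderiv]
    refine HasLineDerivAt.lineDeriv ?_
    unfold HasLineDerivAt
    simp only [hw]
    simpa using ((hasDerivAt_id (0 : ℝ)).smul_const w).const_add (V x)
  have h1 := deriv_pullback_eq_zero hU hφ hx (hV x) h u
  have h2 := deriv_pullback_eq_zero hU hφ (V := fun _ => u) hx (by fun_prop) hu (V x)
  have hs : IsSymmSndFDerivAt ℝ φ x :=
    (hφ.contDiffAt (hU.mem_nhds hx)).isSymmSndFDerivAt
      (by rw [minSmoothness_of_isRCLikeNormedField]; norm_cast)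
  rw [hs (V x) u] at h2
  rw [hw'] at h1
  simp at h2
  linarith

end FlagGeometry

section ElementaryModel

/-- The index of the leading differential in each form of the model. -/
def leadIdx : Fin 7 → Fin 9 := ![1, 2, 0, 4, 3, 5, 7]

/-- The index of the second differential in each form of the model. -/
def baseIdx : Fin 7 → Fin 9 := ![0, 0, 3, 3, 5, 6, 6]

theorem model31331_apply (k : Fin 7) (x v : Fin 9 → ℝ) :
    model31331 k x v = v (leadIdx k) + x k.succ.succ * v (baseIdx k) := by
  fin_cases k <;> simp [model31331, dxi, leadIdx, baseIdx]

/-- The coordinate vector field `∂/∂xⁱ`. -/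
abbrev coordField (i : Fin 9) : Fin 9 → ℝ := Pi.single i 1

/-- The kernel direction of the forms `0, 1` in the coordinates `0, …, 3`. -/
def leg1 (x : Fin 9 → ℝ) : Fin 9 → ℝ := coordField 0 - x 2 • coordField 1 - x 3 • coordField 2

/-- The kernel direction of the forms `0, …, 3` in the coordinates `0, …, 5`. -/
def leg3 (x : Fin 9 → ℝ) : Fin 9 → ℝ := coordField 3 - x 4 • leg1 x - x 5 • coordField 4

/-- The kernel direction of the forms `0, …, 4` in the coordinates `0, …, 6`. -/
def leg4 (x : Fin 9 → ℝ) : Fin 9 → ℝ := coordField 5 - x 6 • leg3 x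

/-- The kernel direction of the forms `0, …, 5` in the coordinates `0, …, 7`. -/
def leg5 (x : Fin 9 → ℝ) : Fin 9 → ℝ := coordField 6 - x 7 • leg4 x

/-- The field `leg i` spans, with the coordinate fields of index at least `i + 2`, the common
kernel of the forms `0, …, i` of the model. -/
def leg : Fin 7 → (Fin 9 → ℝ) → (Fin 9 → ℝ) :=
  ![fun x => coordField 0 - x 2 • coordField 1, leg1, fun x => coordField 3 - x 4 • leg1 x, leg3,
    leg4, leg5, fun x => leg5 x - x 8 • coordField 7]

/-- The field `transversal i` is dual to the form `i` and is annihilated by the previous forms. -/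
def transversal : Fin 7 → (Fin 9 → ℝ) → (Fin 9 → ℝ) :=
  ![fun _ => coordField 1, fun _ => coordField 2, leg1, fun _ => coordField 4, leg3, leg4,
    fun _ => coordField 7]

@[fun_prop]
theorem differentiable_leg1 : Differentiable ℝ leg1 := by unfold leg1; fun_prop

@[fun_prop]
theorem differentiable_leg3 : Differentiable ℝ leg3 := by unfold leg3; fun_prop

@[fun_prop]
theorem differentiable_leg4 : Differentiable ℝ leg4 := by unfold leg4; fun_prop

@[fun_prop]
theorem differentiable_leg5 : Differentiable ℝ leg5 := by unfold leg5; fun_prop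

theorem differentiable_leg (i : Fin 7) : Differentiable ℝ (leg i) := by
  fin_cases i <;> simp only [leg] <;> dsimp <;> fun_prop

theorem differentiable_transversal (i : Fin 7) : Differentiable ℝ (transversal i) := by
  fin_cases i <;> simp only [transversal] <;> dsimp <;> fun_prop

theorem model31331_leg (i k : Fin 7) (h : k ≤ i) (x : Fin 9 → ℝ) :
    model31331 k x (leg i x) = 0 := by
  rw [model31331_apply]
  fin_cases i <;> fin_cases k <;> first
    | (exfalso; revert h; decide)
    | (simp [leadIdx, baseIdx, leg, leg1, leg3, leg4, leg5]; try ring)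

theorem model31331_transversal (i k : Fin 7) (h : k ≤ i) (x : Fin 9 → ℝ) :
    model31331 k x (transversal i x) = if k = i then 1 else 0 := by
  rw [model31331_apply]
  fin_cases i <;> fin_cases k <;> first
    | (exfalso; revert h; decide)
    | (simp [leadIdx, baseIdx, transversal, leg1, leg3, leg4]; try ring)

theorem leg_add_smul_coordField (i : Fin 7) (x : Fin 9 → ℝ) (t : ℝ) :
    leg i (x + t • coordField i.succ.succ) = leg i x + t • -transversal i x := by
  fin_cases i <;> ext j <;>
    (simp [leg, transversal, leg1, leg3, leg4, leg5]; try ring)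

theorem transversal_add_smul_coordField (i : Fin 7) (j : Fin 9) (h : i.val + 2 ≤ j.val)
    (x : Fin 9 → ℝ) (t : ℝ) :
    transversal i (x + t • coordField j) = transversal i x := by
  fin_cases i <;> fin_cases j <;> first
    | (exfalso; revert h; decide)
    | simp [transversal, leg1, leg3, leg4]

/-- The bases of two consecutive kernels. -/
theorem leg_succ_cases (i : Fin 6) :
    (∀ x, transversal i.succ x = coordField i.succ.succ.castSucc ∧
      leg i.castSucc x = leg i.succ x + x i.succ.succ.succ • transversal i.succ x) ∨
    (∀ x, transversal i.succ x = leg i.castSucc x ∧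
      coordField i.succ.succ.castSucc
        = leg i.succ x + x i.succ.succ.succ • transversal i.succ x) := by
  fin_cases i
  · left; intro x; simp [leg, transversal, leg1]
  · right; intro x; simp [leg, transversal]
  · left; intro x; simp [leg, transversal, leg3]
  · right; intro x; simp [leg, transversal, leg4]
  · right; intro x; simp [leg, transversal, leg5]
  · left; intro x; simp [leg, transversal]

end ElementaryModel

section LocalAutomorphism

variable {U : Set (Fin 9 → ℝ)} {φ : (Fin 9 → ℝ) → (Fin 9 → ℝ)}

theorem baseIdx_succ_cases (k : Fin 6) :
    (leadIdx k.succ = k.castSucc.succ.succ ∧ baseIdx k.succ = baseIdx k.castSucc) ∨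
      (leadIdx k.succ = baseIdx k.castSucc ∧ baseIdx k.succ = k.castSucc.succ.succ) := by
  revert k; decide

/-- The structure equation `dω^k = ± ω^{k+1} ∧ dx^b` combined with Cartan's formula. -/
theorem model31331_pullback_bracket (hU : IsOpen U) (hφ : ContDiffOn ℝ (⊤ : ℕ∞) φ U) (k : Fin 6)
    {V : (Fin 9 → ℝ) → (Fin 9 → ℝ)} (hV : Differentiable ℝ V) {u : Fin 9 → ℝ}
    (h : ∀ y ∈ U, model31331 k.castSucc (φ y) (fderiv ℝ φ y (V y)) = 0)
    (hu : ∀ y ∈ U, model31331 k.castSucc (φ y) (fderiv ℝ φ y u) = 0)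
    {x w : Fin 9 → ℝ} (hx : x ∈ U) (hw : ∀ t : ℝ, V (x + t • u) = V x + t • w) :
    ∃ s : ℝ, s ≠ 0 ∧ model31331 k.castSucc (φ x) (fderiv ℝ φ x w) =
      s * (model31331 k.succ (φ x) (fderiv ℝ φ x (V x)) * fderiv ℝ φ x u (baseIdx k.succ)
        - model31331 k.succ (φ x) (fderiv ℝ φ x u) * fderiv ℝ φ x (V x) (baseIdx k.succ)) := by
  simp only [model31331_apply] at h hu ⊢
  rw [pullback_bracket hU hφ hV h hu hx hw]
  rcases baseIdx_succ_cases k with ⟨ha, hb⟩ | ⟨ha, hb⟩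
  · exact ⟨1, one_ne_zero, by rw [ha, hb]; ring⟩
  · exact ⟨-1, by norm_num, by rw [ha, hb]; ring⟩

/-- A local automorphism of the model preserves every member of its derived flag. -/
theorem model31331_pullback_flag (hU : IsOpen U) (hφ : ContDiffOn ℝ (⊤ : ℕ∞) φ U)
    (hS : ∀ x ∈ U, pullbackSpanAt model31331 φ x = spanAt model31331 x) (i : Fin 7) :
    ∀ k ≤ i, ∀ x ∈ U, model31331 k (φ x) (fderiv ℝ φ x (leg i x)) = 0 ∧
      ∀ j : Fin 9, i.val + 2 ≤ j.val → model31331 k (φ x) (fderiv ℝ φ x (coordField j)) = 0 := by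
  induction i using Fin.reverseInduction with
  | last =>
    intro k _ x hx
    have key : ∀ v : Fin 9 → ℝ, (∀ j, model31331 j x v = 0) →
        model31331 k (φ x) (fderiv ℝ φ x v) = 0 := by
      intro v hv
      have hk : (model31331 k (φ x)).comp (fderiv ℝ φ x) ∈ spanAt model31331 x := by
        rw [← hS x hx]
        exact Submodule.subset_span ⟨k, rfl⟩
      exact Submodule.span_induction (p := fun l _ => l v = 0)
        (by rintro _ ⟨j, rfl⟩; exact hv j) rfl
        (fun a b _ _ ha hb => by simp [ha, hb]) (fun c a _ ha => by simp [ha]) hk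
    refine ⟨key _ fun j => model31331_leg _ _ (Fin.le_last j) x, fun j hj => key _ fun l => ?_⟩
    obtain rfl : j = 8 := by ext; simp at hj ⊢; omega
    rw [model31331_apply]
    fin_cases l <;> simp [leadIdx, baseIdx]
  | cast i ih =>
    intro k hk x hx
    obtain ⟨k, rfl⟩ : ∃ k' : Fin 6, k = k'.castSucc :=
      ⟨⟨k.val, lt_of_le_of_lt (Fin.le_def.1 hk) i.isLt⟩, rfl⟩
    have hki : k ≤ i := hk
    have h1 : k.castSucc ≤ i.succ := hk.trans (Fin.castSucc_lt_succ).le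
    have h2 : k.succ ≤ i.succ := Fin.succ_le_succ_iff.2 hki
    have hj : i.succ.val + 2 ≤ (i.succ.succ.succ : Fin 9).val := by simp
    obtain ⟨s, -, hs⟩ := model31331_pullback_bracket hU hφ k (differentiable_leg i.succ)
      (fun y hy => (ih _ h1 y hy).1) (fun y hy => (ih _ h1 y hy).2 _ hj) hx
      (leg_add_smul_coordField i.succ x)
    rw [(ih _ h2 x hx).1, (ih _ h2 x hx).2 _ hj] at hs
    have hM : model31331 k.castSucc (φ x) (fderiv ℝ φ x (transversal i.succ x)) = 0 := by
      simpa using hs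
    have hN : model31331 k.castSucc (φ x) (fderiv ℝ φ x
        (leg i.succ x + x i.succ.succ.succ • transversal i.succ x)) = 0 := by
      simp [hM, (ih _ h1 x hx).1]
    have hc : model31331 k.castSucc (φ x) (fderiv ℝ φ x (leg i.castSucc x)) = 0 ∧
        model31331 k.castSucc (φ x) (fderiv ℝ φ x (coordField i.succ.succ.castSucc)) = 0 := by
      rcases leg_succ_cases i with h | h <;> obtain ⟨e1, e2⟩ := h x
      · rw [e2, ← e1]; exact ⟨hN, hM⟩
      · rw [e2, ← e1]; exact ⟨hM, hN⟩
    refine ⟨hc.1, fun j hj => ?_⟩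
    rcases Nat.eq_or_lt_of_le hj with hj | hj
    · obtain rfl : j = i.succ.succ.castSucc := by ext; simp at hj ⊢; omega
      exact hc.2
    · exact (ih _ h1 x hx).2 j (by simp at hj ⊢; omega)

theorem model31331_pullback_transversal_of_lt (hU : IsOpen U) (hφ : ContDiffOn ℝ (⊤ : ℕ∞) φ U)
    (hS : ∀ x ∈ U, pullbackSpanAt model31331 φ x = spanAt model31331 x) {k i : Fin 7} (h : k < i)
    {x : Fin 9 → ℝ} (hx : x ∈ U) :
    model31331 k (φ x) (fderiv ℝ φ x (transversal i x)) = 0 := by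
  obtain ⟨i, rfl⟩ : ∃ i' : Fin 6, i = i'.succ := ⟨i.pred (Fin.ne_zero_of_lt h), by simp⟩
  have hk : k ≤ i.castSucc := Fin.le_castSucc_iff.2 h
  have H := model31331_pullback_flag hU hφ hS i.castSucc k hk x hx
  rcases leg_succ_cases i with h | h <;> rw [(h x).1]
  · exact H.2 _ (by simp)
  · exact H.1

theorem model31331_pullback_transversal_ne_zero (hU : IsOpen U)
    (hφ : ContDiffOn ℝ (⊤ : ℕ∞) φ U)
    (hS : ∀ x ∈ U, pullbackSpanAt model31331 φ x = spanAt model31331 x) (k : Fin 7)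
    {x : Fin 9 → ℝ} (hx : x ∈ U) :
    model31331 k (φ x) (fderiv ℝ φ x (transversal k x)) ≠ 0 := by
  have hC : ∀ i, ∃ c : Fin 7 → ℝ,
      ∑ j, c j • (model31331 j (φ x)).comp (fderiv ℝ φ x) = model31331 i x := by
    intro i
    have : model31331 i x ∈ pullbackSpanAt model31331 φ x := by
      rw [hS x hx]; exact Submodule.subset_span ⟨i, rfl⟩
    exact (Submodule.mem_span_range_iff_exists_fun ℝ).1 this
  choose C hC using hC
  let F : Matrix (Fin 7) (Fin 7) ℝ :=
    Matrix.of fun i j => model31331 i (φ x) (fderiv ℝ φ x (transversal j x))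
  let G : Matrix (Fin 7) (Fin 7) ℝ := Matrix.of fun i j => model31331 i x (transversal j x)
  have hG : Matrix.of C * F = G := by
    ext i j
    have := congrArg (fun l => l (transversal j x)) (hC i)
    simpa [Matrix.mul_apply, F, G] using this
  have hGdet : G.det = 1 := by
    rw [Matrix.det_of_isLowerTriangular G fun i j (hij : i < j) => by
      simp [G, model31331_transversal _ _ hij.le, hij.ne]]
    simp [G, model31331_transversal]
  have hF : F.det = ∏ i, F i i := by
    refine Matrix.det_of_isLowerTriangular F fun i j hij => ?_
    exact model31331_pullback_transversal_of_lt hU hφ hS hij hx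
  have hne : F.det ≠ 0 := by
    intro h0
    rw [← hG, Matrix.det_mul, h0] at hGdet
    simp at hGdet
  rw [hF] at hne
  exact Finset.prod_ne_zero_iff.1 hne k (Finset.mem_univ k)

/-- Components of a local automorphism do not depend on later coordinates. -/
theorem fderiv_coordField_eq_zero (hU : IsOpen U) (hφ : ContDiffOn ℝ (⊤ : ℕ∞) φ U)
    (hS : ∀ x ∈ U, pullbackSpanAt model31331 φ x = spanAt model31331 x) (k : Fin 6) (j : Fin 9)
    (hj : k.val + 3 ≤ j.val) {x : Fin 9 → ℝ} (hx : x ∈ U) :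
    fderiv ℝ φ x (coordField j) k.castSucc.succ.succ = 0 ∧
      fderiv ℝ φ x (coordField j) (baseIdx k.castSucc) = 0 := by
  have H := model31331_pullback_flag hU hφ hS
  have h1 : model31331 k.succ (φ x) (fderiv ℝ φ x (coordField j)) = 0 :=
    (H k.succ k.succ le_rfl x hx).2 j (by simp; omega)
  obtain ⟨s, hs0, hs⟩ := model31331_pullback_bracket hU hφ k (w := 0) (u := coordField j)
    (differentiable_transversal k.succ)
    (fun y hy => model31331_pullback_transversal_of_lt hU hφ hS Fin.castSucc_lt_succ hy)
    (fun y hy => (H k.castSucc k.castSucc le_rfl y hy).2 j (by simp; omega)) hx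
    (fun t => by
      rw [transversal_add_smul_coordField _ _ (by simp; omega)]; simp)
  have hne := model31331_pullback_transversal_ne_zero hU hφ hS k.succ hx
  rw [h1] at hs
  have hb : fderiv ℝ φ x (coordField j) (baseIdx k.succ) = 0 := by
    simpa [hs0, hne] using hs
  have ha : fderiv ℝ φ x (coordField j) (leadIdx k.succ) = 0 := by
    simpa [model31331_apply, hb] using h1
  rcases baseIdx_succ_cases k with ⟨h, h'⟩ | ⟨h, h'⟩ <;> rw [h] at ha <;> rw [h'] at hb
  · exact ⟨ha, hb⟩
  · exact ⟨hb, ha⟩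

/-- The diagonal coefficients of a local automorphism in terms of its Jacobian. -/
theorem model31331_pullback_transversal_eq (hU : IsOpen U) (hφ : ContDiffOn ℝ (⊤ : ℕ∞) φ U)
    (hS : ∀ x ∈ U, pullbackSpanAt model31331 φ x = spanAt model31331 x) (k : Fin 6)
    {x : Fin 9 → ℝ} (hx : x ∈ U) :
    model31331 k.succ (φ x) (fderiv ℝ φ x (transversal k.succ x))
      = fderiv ℝ φ x (coordField k.succ.succ.succ) k.succ.succ.succ
        * fderiv ℝ φ x (leg k.succ x) (baseIdx k.succ) := by
  have H := model31331_pullback_flag hU hφ hS k.succ k.succ le_rfl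
  have hb : fderiv ℝ φ x (coordField k.succ.succ.succ) (baseIdx k.succ) = 0 := by
    have h := fderiv_coordField_eq_zero hU hφ hS k k.succ.succ.succ (by simp) hx
    rcases baseIdx_succ_cases k with ⟨-, h'⟩ | ⟨-, h'⟩ <;> rw [h']
    · exact h.2
    · exact h.1
  have h := pullback_bracket hU hφ (differentiable_leg k.succ)
    (fun y hy => model31331_apply k.succ _ _ ▸ (H y hy).1)
    (fun y hy => model31331_apply k.succ _ _ ▸ (H y hy).2 k.succ.succ.succ (by simp)) hx
    (leg_add_smul_coordField k.succ x)
  rw [← model31331_apply, hb] at h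
  simp only [map_neg] at h
  linarith

theorem apply_eq_zero_of_fderiv_leg_eq_zero (hU : IsOpen U) (hφ : ContDiffOn ℝ (⊤ : ℕ∞) φ U)
    (hS : ∀ x ∈ U, pullbackSpanAt model31331 φ x = spanAt model31331 x) (k : Fin 6)
    {x : Fin 9 → ℝ} (hx : x ∈ U) (h : fderiv ℝ φ x (leg k.succ x) (leadIdx k.succ) = 0) :
    φ x k.succ.succ.succ = 0 := by
  have h1 := (model31331_pullback_flag hU hφ hS k.succ k.succ le_rfl x hx).1
  have h2 := model31331_pullback_transversal_ne_zero hU hφ hS k.succ hx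
  rw [model31331_pullback_transversal_eq hU hφ hS k hx] at h2
  rw [model31331_apply, h, zero_add] at h1
  exact (mul_eq_zero.1 h1).resolve_right (right_ne_zero_of_mul h2)

theorem fderiv_coordField_eq_zero_of_hyperplane (hU : IsOpen U)
    (hφ : ContDiffOn ℝ (⊤ : ℕ∞) φ U) {c i : Fin 9} (hic : i ≠ c)
    (h : ∀ x ∈ U, x c = 0 → φ x c = 0) {p : Fin 9 → ℝ} (hp : p ∈ U) (hpc : p c = 0) :
    fderiv ℝ φ p (coordField i) c = 0 := by
  have hd : HasFDerivAt φ (fderiv ℝ φ p) p :=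
    ((hφ.contDiffAt (hU.mem_nhds hp)).differentiableAt (by simp)).hasFDerivAt
  have h1 : HasDerivAt (fun t : ℝ => φ (p + t • coordField i) c)
      (fderiv ℝ φ p (coordField i) c) 0 :=
    (hasFDerivAt_pi'.1 hd c).hasLineDerivAt (coordField i)
  have hmem : ∀ᶠ t : ℝ in nhds 0, p + t • coordField i ∈ U := by
    have : Continuous fun t : ℝ => p + t • coordField i := by fun_prop
    exact this.continuousAt.eventually (hU.mem_nhds (by simpa using hp))
  refine h1.unique ((hasDerivAt_const (0 : ℝ) (0 : ℝ)).congr_of_eventuallyEq ?_)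
  filter_upwards [hmem] with t ht
  exact h _ ht (by simp [hpc, hic.symm])

/-- The sign of the last coordinate is invariant on the stratum through `p` and `q`. -/
theorem exists_last_eq_mul_sq (hU : IsOpen U) (hφ : ContDiffOn ℝ (⊤ : ℕ∞) φ U)
    (hS : ∀ x ∈ U, pullbackSpanAt model31331 φ x = spanAt model31331 x) {s t : ℝ}
    (hp : ![0, 0, 0, 0, 0, 1, 0, 0, s] ∈ U)
    (hpq : φ ![0, 0, 0, 0, 0, 1, 0, 0, s] = ![0, 0, 0, 0, 0, 1, 0, 0, t]) :
    ∃ r : ℝ, s = t * r ^ 2 := by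
  set p : Fin 9 → ℝ := ![0, 0, 0, 0, 0, 1, 0, 0, s] with hpdef
  have l1 : leg1 p = coordField 0 := by simp [leg1, hpdef]
  have l3 : leg3 p = coordField 3 - coordField 4 := by simp [leg3, hpdef]
  have l4 : leg4 p = coordField 5 := by simp [leg4, hpdef]
  have l5 : leg5 p = coordField 6 := by simp [leg5, hpdef]
  have tri := fun k j hj => fderiv_coordField_eq_zero hU hφ hS k j hj (x := p) hp
  have h43 := (tri 1 4 (by decide)).1
  have h76 := (tri 4 7 (by decide)).1
  have h34 : fderiv ℝ φ p (coordField 3) 4 = 0 := by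
    refine fderiv_coordField_eq_zero_of_hyperplane hU hφ (by decide) (fun x hx hx0 => ?_) hp
      (by simp [hpdef])
    refine apply_eq_zero_of_fderiv_leg_eq_zero hU hφ hS 1 hx ?_
    have : leg 2 x = coordField 3 := by simp [leg, hx0]
    exact this ▸ (fderiv_coordField_eq_zero hU hφ hS 0 3 (by decide) hx).2
  have h67 : fderiv ℝ φ p (coordField 6) 7 = 0 := by
    refine fderiv_coordField_eq_zero_of_hyperplane hU hφ (by decide) (fun x hx hx0 => ?_) hp
      (by simp [hpdef])
    refine apply_eq_zero_of_fderiv_leg_eq_zero hU hφ hS 4 hx ?_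
    have : leg 5 x = coordField 6 := by simp [leg, leg5, hx0]
    exact this ▸ (fderiv_coordField_eq_zero hU hφ hS 3 6 (by decide) hx).1
  have n2 := model31331_pullback_transversal_ne_zero hU hφ hS 2 hp
  have e2 := model31331_pullback_transversal_eq hU hφ hS 1 hp
  have e3 := model31331_pullback_transversal_eq hU hφ hS 2 hp
  have e5 := model31331_pullback_transversal_eq hU hφ hS 4 hp
  have f3 := (model31331_pullback_flag hU hφ hS 3 3 le_rfl p hp).1
  have f6 := (model31331_pullback_flag hU hφ hS 6 6 le_rfl p hp).1
  have p4 : p 4 = 0 := by simp [hpdef]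
  have p8 : p 8 = s := by simp [hpdef]
  simp [model31331_apply, hpq, leg, transversal, l1, l3, l4, l5, leadIdx, baseIdx, Fin.succ, p4, p8,
    h34, h67] at n2 e2 e3 e5 f3 f6 h43 h76
  simp only [h43, h76, add_zero, sub_zero, mul_zero] at e3 f3 f6
  have hα : fderiv ℝ φ p (coordField 3) 3 ≠ 0 := by
    rw [e2] at n2
    exact right_ne_zero_of_mul n2
  have h55 : fderiv ℝ φ p (coordField 5) 5 = 1 := mul_right_cancel₀ hα (by linarith)
  refine ⟨fderiv ℝ φ p (coordField 6) 6, ?_⟩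
  linear_combination (-fderiv ℝ φ p (coordField 6) 6) * f6 + s * e5 - s * h55

end LocalAutomorphism

/-- For the elementary model (3.1.3.3.1.) on `ℝ⁹` there is no
local equivalence taking the point `p = (0,0,0,0,0,1,0,0,1)` to the point
`q = (0,0,0,0,0,1,0,0,−1)`; consequently the flag models (3.𝟐.3.3.𝟐.) and
(3.𝟐.3.3.𝟐−.) (constants of opposite signs at the last position) are not locally
equivalent at the origin. -/
theorem stmt18 :
    (¬ ∃ (U V : Set (Fin 9 → ℝ)) (φ ψ : (Fin 9 → ℝ) → (Fin 9 → ℝ)),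
      IsOpen U ∧ IsOpen V ∧
      (![0, 0, 0, 0, 0, 1, 0, 0, 1] : Fin 9 → ℝ) ∈ U ∧
      (![0, 0, 0, 0, 0, 1, 0, 0, -1] : Fin 9 → ℝ) ∈ V ∧
      φ ![0, 0, 0, 0, 0, 1, 0, 0, 1] = ![0, 0, 0, 0, 0, 1, 0, 0, -1] ∧
      Set.BijOn φ U V ∧
      ContDiffOn ℝ (⊤ : ℕ∞) φ U ∧ ContDiffOn ℝ (⊤ : ℕ∞) ψ V ∧ (∀ x ∈ U, ψ (φ x) = x) ∧
      (∀ x ∈ U, pullbackSpanAt model31331 φ x = spanAt model31331 x))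
    ∧ (¬ ∃ (U V : Set (Fin 9 → ℝ)) (φ ψ : (Fin 9 → ℝ) → (Fin 9 → ℝ)),
      IsOpen U ∧ IsOpen V ∧ (0 : Fin 9 → ℝ) ∈ U ∧ (0 : Fin 9 → ℝ) ∈ V ∧
      φ 0 = 0 ∧ Set.BijOn φ U V ∧
      ContDiffOn ℝ (⊤ : ℕ∞) φ U ∧ ContDiffOn ℝ (⊤ : ℕ∞) ψ V ∧ (∀ x ∈ U, ψ (φ x) = x) ∧
      (∀ x ∈ U, pullbackSpanAt model32332p φ x = spanAt model32332m x)) := by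
  constructor
  · rintro ⟨U, V, φ, ψ, hU, -, hp, -, hpq, -, hφ, -, -, hS⟩
    obtain ⟨r, hr⟩ := exists_last_eq_mul_sq hU hφ hS hp hpq
    nlinarith [sq_nonneg r]
  · rintro ⟨U, V, φ, ψ, hU, -, h0, -, h00, -, hφ, -, -, hS⟩
    set p : Fin 9 → ℝ := ![0, 0, 0, 0, 0, 1, 0, 0, 1] with hp
    set q : Fin 9 → ℝ := ![0, 0, 0, 0, 0, 1, 0, 0, -1] with hq
    have hpm : ∀ x, spanAt model32332m x = spanAt model31331 (x + q) := by
      intro x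
      refine congrArg (fun f => Submodule.span ℝ (Set.range f)) (funext fun i => ?_)
      fin_cases i <;> simp [model32332m, model31331, hq, sub_eq_add_neg, -Matrix.add_cons]
    have hpp : ∀ i x, model31331 i (x + p) = model32332p i x := by
      intro i x
      fin_cases i <;> simp [model32332p, model31331, hp, -Matrix.add_cons]
    have hsub : ContDiff ℝ (⊤ : ℕ∞) fun x : Fin 9 → ℝ => x - q := by fun_prop
    obtain ⟨r, hr⟩ := exists_last_eq_mul_sq (U := (fun x => x - q) ⁻¹' U)
      (φ := fun x => φ (x - q) + p) (s := -1) (t := 1)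
      (hU.preimage hsub.continuous)
      ((hφ.comp hsub.contDiffOn fun x hx => hx).add contDiffOn_const)
      (fun x hx => by
        have h := hS (x - q) hx
        rw [hpm, sub_add_cancel] at h
        rw [← h]
        unfold pullbackSpanAt
        simp only [hpp, fderiv_add_const, fderiv_comp_sub])
      (by simpa [← hq] using h0) (by simp [← hq, ← hp, h00])
    nlinarith [sq_nonneg r]
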